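/- Merging EHEs with incorporated memories refines the merged memory: let A be a deterministic and complete specification automaton, 𝒱 = 𝒱^n = move([(0, q0) ↦ tt], 0, n), and let ℳ1, ℳ2 be memories with no conflicting observations; set 𝒱1 = inc(𝒱, ℳ1), 𝒱2 = inc(𝒱, ℳ2), 𝒱' = 𝒱1 ⊎∨ 𝒱2. Then for every (t, q) ∈ dom 𝒱': if eval(𝒱'(t, q), ∅) = ⊤ then eval(𝒱(t, q), ℳ1 ⊎² ℳ2) = ⊤, where ∅ is the empty memory and ⊎² is memory merge. -/

import Mathlib

open Classical

namespace DecSpec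

/-- Merge of two dicts (partial functions) with a binary operation `op`. -/
def dmerge {α β : Type*} (op : β → β → β) (f g : α → Option β) : α → Option β :=
  fun x =>
    match f x, g x with
    | some a, some b => some (op a b)
    | some a, none   => some a
    | none,   some b => some b
    | none,   none   => none

/-- Boolean expressions over atoms `A`. -/
inductive Expr (A : Type*) : Type _ where
  | tt : Expr A
  | ff : Expr A
  | atom : A → Expr A
  | not : Expr A → Expr A
  | and : Expr A → Expr A → Expr A
  | or : Expr A → Expr A → Expr A

/-- Boolean semantics of an expression under a valuation. -/
def Expr.evalv {A : Type*} (v : A → Bool) : Expr A → Bool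
  | .tt => true
  | .ff => false
  | .atom a => v a
  | .not e => !(e.evalv v)
  | .and e1 e2 => e1.evalv v && e2.evalv v
  | .or e1 e2 => e1.evalv v || e2.evalv v

/-- Semantic equivalence of expressions. -/
def Expr.equiv {A : Type*} (e e' : Expr A) : Prop := ∀ v, e.evalv v = e'.evalv v

/-- Apply an encoder to every atom of an expression. -/
def Expr.map {A B : Type*} (f : A → B) : Expr A → Expr B
  | .tt => .tt
  | .ff => .ff
  | .atom a => .atom (f a)
  | .not e => .not (e.map f)
  | .and e1 e2 => .and (e1.map f) (e2.map f)
  | .or e1 e2 => .or (e1.map f) (e2.map f)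

/-- The set of atoms occurring in an expression. -/
def Expr.atoms {A : Type*} : Expr A → Set A
  | .tt => ∅
  | .ff => ∅
  | .atom a => {a}
  | .not e => e.atoms
  | .and e1 e2 => e1.atoms ∪ e2.atoms
  | .or e1 e2 => e1.atoms ∪ e2.atoms

/-- The three-valued verdict domain 𝔹₃ = {⊤, ⊥, ?}. -/
inductive Verdict : Type where
  | vt | vf | vna
deriving DecidableEq

/-- A memory is a partial function from atoms to verdicts. -/
abbrev Mem (A : Type*) := A → Option Verdict

/-- The empty memory. -/
def emptyMem {A : Type*} : Mem A := fun _ => none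

/-- Rewrite an expression using a memory: replace atoms carrying final verdicts. -/
def Expr.rw {A : Type*} (M : Mem A) : Expr A → Expr A
  | .tt => .tt
  | .ff => .ff
  | .atom a =>
    match M a with
    | some .vt => .tt
    | some .vf => .ff
    | _ => .atom a
  | .not e => .not (e.rw M)
  | .and e1 e2 => .and (e1.rw M) (e2.rw M)
  | .or e1 e2 => .or (e1.rw M) (e2.rw M)

def Expr.tautology {A : Type*} (e : Expr A) : Prop := ∀ v, e.evalv v = true
def Expr.unsat {A : Type*} (e : Expr A) : Prop := ∀ v, e.evalv v = false

/-- Evaluate an expression against a memory: ⊤ if the rewrite is a tautology,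
⊥ if it is unsatisfiable, ? otherwise. -/
noncomputable def evalM {A : Type*} (e : Expr A) (M : Mem A) : Verdict :=
  if (e.rw M).tautology then .vt
  else if (e.rw M).unsat then .vf
  else .vna

/-- A valuation is consistent with a memory. -/
def consistent {A : Type*} (v : A → Bool) (M : Mem A) : Prop :=
  (∀ a, M a = some .vt → v a = true) ∧ (∀ a, M a = some .vf → v a = false)

/-- An event assigns at most one final verdict (modeled as a `Bool`) to each
atomic proposition. -/
abbrev Event (AP : Type*) := AP → Option Bool

def Event.nonempty {AP : Type*} (evt : Event AP) : Prop := ∃ ap, evt ap ≠ none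

/-- Final verdicts as verdicts. -/
def b2v : Bool → Verdict := fun b => if b then .vt else .vf

/-- `cons(evt, id)`: the memory over `AP` built from an event with the identity encoder. -/
def consId {AP : Type*} (evt : Event AP) : Mem AP := fun ap => (evt ap).map b2v

/-- The timestamp encoder `ts_t`. -/
def tsEnc {AP : Type*} (t : ℕ) (ap : AP) : ℕ × AP := (t, ap)

/-- `⊎²_{t ∈ [1, i]} cons(evt_t, ts_t)`: the memory over timestamped atoms built
from the events at timestamps `1, …, i` with the timestamp encoders. -/
def tsMem {AP : Type*} (evts : ℕ → Event AP) (i : ℕ) : Mem (ℕ × AP) :=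
  fun p => if 1 ≤ p.1 ∧ p.1 ≤ i then (evts p.1 p.2).map b2v else none

/-- A specification (Moore) automaton. -/
structure SpecAut (AP : Type*) (Q : Type*) where
  q0 : Q
  δ : Q → Expr AP → Option Q
  ver : Q → Verdict

variable {AP Q : Type*}

/-- At most one labeled transition between each ordered pair of states. -/
def SpecAut.UniqueLabels (A : SpecAut AP Q) : Prop :=
  ∀ q q' e e', A.δ q e = some q' → A.δ q e' = some q' → e = e'

/-- Determinism: for every state and memory at most one outgoing label
evaluates to ⊤. -/
def SpecAut.Deterministic (A : SpecAut AP Q) : Prop :=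
  ∀ (q : Q) (M : Mem AP) (e1 e2 : Expr AP) (q1 q2 : Q),
    A.δ q e1 = some q1 → A.δ q e2 = some q2 →
    evalM e1 M = .vt → evalM e2 M = .vt → e1 = e2

/-- Completeness: for every state the disjunction of the outgoing labels is a
tautology. -/
def SpecAut.Complete (A : SpecAut AP Q) : Prop :=
  ∀ (q : Q) (v : AP → Bool), ∃ (e : Expr AP) (q' : Q),
    A.δ q e = some q' ∧ e.evalv v = true

/-- The transition function `Δ` over events. -/
noncomputable def SpecAut.step (A : SpecAut AP Q) (q : Q) (evt : Event AP) : Q :=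
  if h : evt.nonempty ∧ ∃ (q' : Q) (e : Expr AP),
      A.δ q e = some q' ∧ evalM e (consId evt) = .vt
  then h.2.choose
  else q

/-- `Δ*`: the extension of `Δ` to finite sequences of events. -/
noncomputable def SpecAut.run (A : SpecAut AP Q) (q : Q) : List (Event AP) → Q
  | [] => q
  | evt :: rest => A.run (A.step q evt) rest

/-- An Execution History Encoding of `A`. -/
abbrev EHE (AP : Type*) (Q : Type*) := ℕ × Q → Option (Expr (ℕ × AP))

/-- EHE merge `⊎∨`: disjoin expressions at keys in both domains. -/
def eheMerge {AP Q : Type*} (V1 V2 : EHE AP Q) : EHE AP Q := dmerge Expr.or V1 V2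

/-- `to(𝒱, t, q', enc)`: disjunction of `𝒱(t, q) ∧ enc(e')` over all `(q, e')`
with `(t, q) ∈ dom 𝒱` and `δ(q, e') = some q'`. -/
noncomputable def toExpr [Fintype Q] (A : SpecAut AP Q) (V : EHE AP Q) (t : ℕ)
    (q' : Q) (enc : AP → ℕ × AP) : Expr (ℕ × AP) :=
  (Finset.univ : Finset Q).toList.foldr
    (fun q acc =>
      match V (t, q) with
      | none => acc
      | some eV =>
        if h : ∃ e', A.δ q e' = some q' then .or (.and eV (h.choose.map enc)) acc
        else acc)
    .ff

/-- States having a transition from some state in the domain of `𝒱` at `t`. -/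
def nextStates (A : SpecAut AP Q) (V : EHE AP Q) (t : ℕ) (q' : Q) : Prop :=
  ∃ (q : Q) (e' : Expr AP), V (t, q) ≠ none ∧ A.δ q e' = some q'

/-- One step of `move`: `𝒱 ↦ 𝒱 ⊎∨ ⨄∨_{q'} [(t+1, q') ↦ to(𝒱, t, q', ts_{t+1})]`. -/
noncomputable def moveStep [Fintype Q] (A : SpecAut AP Q) (V : EHE AP Q) (t : ℕ) :
    EHE AP Q :=
  eheMerge V (fun p =>
    if p.1 = t + 1 ∧ nextStates A V t p.2
    then some (toExpr A V t p.2 (tsEnc (t + 1)))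
    else none)

noncomputable def moveN [Fintype Q] (A : SpecAut AP Q) (V : EHE AP Q) (t0 : ℕ) :
    ℕ → EHE AP Q
  | 0 => V
  | k + 1 => moveStep A (moveN A V t0 k) (t0 + k)

/-- `move(𝒱, t_s, t_e)`. -/
noncomputable def move [Fintype Q] (A : SpecAut AP Q) (V : EHE AP Q) (ts te : ℕ) :
    EHE AP Q :=
  moveN A V ts (te - ts)

/-- The initial EHE `[(0, q0) ↦ tt]`. -/
noncomputable def initEHE (A : SpecAut AP Q) : EHE AP Q :=
  fun p => if p = (0, A.q0) then some .tt else none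

/-- `reach(𝒱, ℳ, t)`: the state whose expression at `t` evaluates to ⊤, if any. -/
noncomputable def reach {AP Q : Type*} (V : EHE AP Q) (M : Mem (ℕ × AP)) (t : ℕ) :
    Option Q :=
  if h : ∃ (q : Q) (e : Expr (ℕ × AP)), V (t, q) = some e ∧ evalM e M = .vt
  then some h.choose
  else none

/-- `inc(𝒱, ℳ)`: incorporate a memory into an EHE by rewriting every entry. -/
def inc {κ A : Type*} (V : κ → Option (Expr A)) (M : Mem A) : κ → Option (Expr A) :=
  fun k => (V k).map (Expr.rw M)

/-- Two memories have no conflicting observations. -/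
def noConflict {A : Type*} (M1 M2 : Mem A) : Prop :=
  ∀ a v1 v2, M1 a = some v1 → M2 a = some v2 → v1 = v2

/-- A fixed linear order on verdicts (for memory merge `⊎²`). -/
def Verdict.rank : Verdict → ℕ
  | .vna => 0
  | .vf => 1
  | .vt => 2

/-- Maximum of two verdicts under the fixed linear order. -/
def vmax (a b : Verdict) : Verdict := if a.rank ≤ b.rank then b else a

/-- Memory merge `⊎²`: keep the larger verdict at common keys. -/
def memMerge {A : Type*} (M1 M2 : Mem A) : Mem A := dmerge vmax M1 M2


/-- Override a valuation by the final verdicts of a memory. -/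
def ovr {A : Type*} (M : Mem A) (v : A → Bool) : A → Bool := fun a =>
  match M a with
  | some .vt => true
  | some .vf => false
  | _ => v a

theorem evalv_rw {A : Type*} (M : Mem A) (v : A → Bool) (e : Expr A) :
    (e.rw M).evalv v = e.evalv (ovr M v) := by
  induction e with
  | tt => rfl
  | ff => rfl
  | atom a =>
    simp only [Expr.rw, Expr.evalv, ovr]
    rcases M a with _ | (_ | _ | _) <;> rfl
  | not e ih => simp only [Expr.rw, Expr.evalv, ih]
  | and e1 e2 ih1 ih2 => simp only [Expr.rw, Expr.evalv, ih1, ih2]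
  | or e1 e2 ih1 ih2 => simp only [Expr.rw, Expr.evalv, ih1, ih2]

theorem evalM_vt {A : Type*} (e : Expr A) (M : Mem A) :
    evalM e M = .vt ↔ ∀ v, e.evalv (ovr M v) = true := by
  have h : (e.rw M).tautology ↔ ∀ v, e.evalv (ovr M v) = true := by
    simp only [Expr.tautology, evalv_rw]
  rw [← h]
  unfold evalM
  split_ifs <;> simp_all

theorem ovr_merge {A : Type*} (M1 M2 : Mem A) (hnc : noConflict M1 M2) (v : A → Bool) :
    ovr M1 (ovr (memMerge M1 M2) v) = ovr (memMerge M1 M2) v ∧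
    ovr M2 (ovr (memMerge M1 M2) v) = ovr (memMerge M1 M2) v := by
  constructor <;>
  · funext a
    have h := hnc a
    simp only [ovr, memMerge, dmerge]
    rcases h1 : M1 a with _ | (_ | _ | _) <;> rcases h2 : M2 a with _ | (_ | _ | _) <;>
      simp_all [vmax, Verdict.rank]

/-- merging EHEs with incorporated non-conflicting memories
refines the merged memory: if an entry of the merged EHE evaluates to ⊤ under
the empty memory, then the original entry evaluates to ⊤ under the merged
memory `ℳ1 ⊎² ℳ2`. -/
theorem merged_inc_refines {AP Q : Type*} [Fintype AP] [Fintype Q]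
    (A : SpecAut AP Q) (hU : A.UniqueLabels) (hD : A.Deterministic)
    (hC : A.Complete) (n : ℕ) (M1 M2 : Mem (ℕ × AP))
    (hnc : noConflict M1 M2) :
    ∀ (t : ℕ) (q : Q) (e' e : Expr (ℕ × AP)),
      eheMerge (inc (move A (initEHE A) 0 n) M1)
               (inc (move A (initEHE A) 0 n) M2) (t, q) = some e' →
      move A (initEHE A) 0 n (t, q) = some e →
      evalM e' (emptyMem : Mem (ℕ × AP)) = Verdict.vt →
      evalM e (memMerge M1 M2) = Verdict.vt := by
  intro t q e' e h1 h2 h3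
  rw [evalM_vt] at h3 ⊢
  intro v
  simp only [eheMerge, dmerge, inc, h2, Option.map_some, Option.some.injEq] at h1
  subst h1
  have h := h3 (ovr (memMerge M1 M2) v)
  have he : ∀ w : ℕ × AP → Bool, ovr emptyMem w = w := fun w => rfl
  obtain ⟨ha, hb⟩ := ovr_merge M1 M2 hnc v
  simpa only [he, Expr.evalv, evalv_rw, ha, hb, Bool.or_self] using h

end DecSpec
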